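/- Let Ω ⊂ ℂ be a bounded Jordan domain with C^∞ smooth boundary and let U ∈ C^∞(Ω̄). Then there exists φ ∈ C^∞(Ω̄) that vanishes identically on bΩ and such that ∂φ/∂z̄ agrees with U to infinite order on bΩ, i.e. all partial derivatives of ∂φ/∂z̄ − U of every order vanish at every point of bΩ. -/

import Mathlib

open Complex MeasureTheory Metric Set Filter
open scoped ENNReal NNReal Topology

noncomputable section

/-- `Ω` is a bounded Jordan domain with `C^∞` smooth boundary: its boundary Jordan
curve is parametrized by the 1-periodic `C^∞` map `γ` with nonvanishing derivative. -/
structure SmoothJordanDomain (Ω : Set ℂ) (γ : ℝ → ℂ) : Prop where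
  isOpen : IsOpen Ω
  bounded : Bornology.IsBounded Ω
  nonempty : Ω.Nonempty
  periodic : Function.Periodic γ 1
  injOn : InjOn γ (Ico 0 1)
  image : γ '' (Icc 0 1) = frontier Ω
  smooth : ContDiff ℝ (⊤ : ℕ∞) γ
  derivNe : ∀ t : ℝ, deriv γ t ≠ 0

/-- The Cauchy–Riemann operator `∂/∂z̄ = (1/2)(∂/∂x + i ∂/∂y)`. -/
def wirtingerBar (f : ℂ → ℂ) (z : ℂ) : ℂ :=
  (fderiv ℝ f z 1 + I * fderiv ℝ f z I) / 2


lemma iter_smul {f : ℂ → ℂ} (hf : ContDiff ℝ (⊤ : ℕ∞) f) (l : ℝ) (j : ℕ) (x : ℂ) :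
    iteratedFDeriv ℝ j (fun z => l • f z) x = l • iteratedFDeriv ℝ j f x := by
  have h := iteratedFDeriv_const_smul_apply (𝕜 := ℝ) (f := f) (x := x) (i := j) (a := l)
    (hf.contDiffAt.of_le (by exact_mod_cast le_top))
  exact h

lemma bdd_derivs {f : ℂ → ℂ} (hf : ContDiff ℝ (⊤ : ℕ∞) f) (hc : HasCompactSupport f) (k : ℕ) :
    ∃ C : ℝ, 1 ≤ C ∧ ∀ n ≤ k, ∀ x, ‖iteratedFDeriv ℝ n f x‖ ≤ C := by
  have h : ∀ n : ℕ, ∃ C : ℝ, ∀ x, ‖iteratedFDeriv ℝ n f x‖ ≤ C := fun n =>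
    (hc.iteratedFDeriv n).exists_bound_of_continuous
      (hf.continuous_iteratedFDeriv (by exact_mod_cast le_top))
  choose C hC using h
  refine ⟨1 + ∑ n ∈ Finset.range (k + 1), |C n|, ?_, ?_⟩
  · have : 0 ≤ ∑ n ∈ Finset.range (k + 1), |C n| := Finset.sum_nonneg fun _ _ => abs_nonneg _
    linarith
  · intro n hn x
    have h1 : |C n| ≤ ∑ n ∈ Finset.range (k + 1), |C n| :=
      Finset.single_le_sum (f := fun n => |C n|) (fun _ _ => abs_nonneg _)
        (Finset.mem_range.2 (by omega))
    linarith [hC n x, le_abs_self (C n)]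

lemma borel_term {c ρ χ : ℂ → ℂ} (hc : ContDiff ℝ (⊤ : ℕ∞) c) (hcc : HasCompactSupport c)
    (hρ : ContDiff ℝ (⊤ : ℕ∞) ρ) (hρc : HasCompactSupport ρ)
    (hχ : ContDiff ℝ (⊤ : ℕ∞) χ) (hχc : HasCompactSupport χ) (k : ℕ) {ε : ℝ} (hε : 0 < ε) :
    ∃ l : ℝ, 0 < l ∧ ∀ n ≤ k, ∀ x,
      ‖iteratedFDeriv ℝ n (fun z => c z * (ρ z) ^ (k + 1) * χ (l • ρ z)) x‖ ≤ ε := by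
  obtain ⟨A, hA1, hA⟩ := bdd_derivs hc hcc k
  obtain ⟨M, hM1, hM⟩ := bdd_derivs hρ hρc k
  have hg : ContDiff ℝ (⊤ : ℕ∞) (fun w : ℂ => w ^ (k + 1) * χ w) := by fun_prop
  obtain ⟨C, hC1, hC⟩ := bdd_derivs hg hχc.mul_left k
  set E : ℝ := 2 ^ k * A * (k.factorial * C * M ^ k) with hE
  have hE0 : 0 < E := by positivity
  set l : ℝ := max 1 (E / ε) with hl
  have hl1 : 1 ≤ l := le_max_left _ _
  have hl0 : 0 < l := by linarith
  refine ⟨l, hl0, ?_⟩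
  intro n hn x
  have hlρ : ContDiff ℝ (⊤ : ℕ∞) (fun z => l • ρ z) := by fun_prop
  have hh : ∀ i ≤ k, ‖iteratedFDeriv ℝ i ((fun w : ℂ => w ^ (k + 1) * χ w) ∘ fun z => l • ρ z) x‖
      ≤ k.factorial * C * M ^ k * l ^ k := by
    intro i hi
    have h1 := norm_iteratedFDeriv_comp_le (n := i) (D := l * M) (C := C) hg hlρ
      (by exact_mod_cast le_top) x (fun j hj => hC j (by omega) _) (by
        intro j hj1 hj
        have : iteratedFDeriv ℝ j (fun z => l • ρ z) x = l • iteratedFDeriv ℝ j ρ x :=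
          iter_smul hρ l j x
        rw [this, norm_smul, Real.norm_eq_abs, abs_of_pos hl0]
        calc l * ‖iteratedFDeriv ℝ j ρ x‖ ≤ l * M := by gcongr; exact hM j (by omega) x
          _ ≤ (l * M) ^ j := le_self_pow₀ (by nlinarith) (by omega))
    refine h1.trans ?_
    rw [mul_pow]
    calc (i.factorial : ℝ) * C * (l ^ i * M ^ i) ≤ k.factorial * C * (l ^ k * M ^ k) := by
          gcongr
      _ = _ := by ring
  have e1 : (fun z => c z * (ρ z) ^ (k + 1) * χ (l • ρ z)) =
      fun z => (l ^ (k + 1))⁻¹ •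
        (c z * ((fun w : ℂ => w ^ (k + 1) * χ w) ∘ fun z => l • ρ z) z) := by
    funext z
    simp only [Function.comp, real_smul, mul_pow]
    push_cast
    have : (l : ℂ) ≠ 0 := by exact_mod_cast hl0.ne'
    field_simp
  rw [e1]
  have hcomp := hg.comp hlρ
  rw [iter_smul (hc.mul hcomp), norm_smul]
  have h2 := norm_iteratedFDeriv_mul_le (n := n) hc hcomp x (by exact_mod_cast le_top)
  have h3 : ‖iteratedFDeriv ℝ n (fun z => c z * ((fun w : ℂ => w ^ (k + 1) * χ w) ∘
      fun z => l • ρ z) z) x‖ ≤ E * l ^ k := by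
    refine h2.trans ?_
    calc _ ≤ ∑ i ∈ Finset.range (n + 1), (n.choose i : ℝ) * A * (k.factorial * C * M ^ k * l ^ k) := by
          refine Finset.sum_le_sum fun i hi => ?_
          have := Finset.mem_range.1 hi
          gcongr
          · exact hA i (by omega) x
          · exact hh _ (by omega)
      _ = 2 ^ n * A * (k.factorial * C * M ^ k * l ^ k) := by
          rw [← Finset.sum_mul, ← Finset.sum_mul]
          congr 2
          exact_mod_cast Nat.sum_range_choose n
      _ ≤ 2 ^ k * A * (k.factorial * C * M ^ k * l ^ k) := by
          gcongr
          norm_num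
      _ = _ := by rw [hE]; ring
  rw [norm_inv, Real.norm_eq_abs, abs_of_pos (by positivity : 0 < l ^ (k + 1)),
    inv_mul_le_iff₀ (by positivity)]
  refine h3.trans ?_
  have h4 : E ≤ l * ε := by
    rw [← div_le_iff₀ hε]; exact le_max_right _ _
  calc E * l ^ k ≤ l * ε * l ^ k := by gcongr
    _ = _ := by ring

/-- Vanishing to order `a` at `q`. -/
def VanAt (a : ℕ) (f : ℂ → ℂ) (q : ℂ) : Prop := ∀ j < a, iteratedFDeriv ℝ j f q = 0

lemma VanAt.mul {a b : ℕ} {f g : ℂ → ℂ} {q : ℂ} (hf : ContDiff ℝ (⊤ : ℕ∞) f)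
    (hg : ContDiff ℝ (⊤ : ℕ∞) g) (h1 : VanAt a f q) (h2 : VanAt b g q) :
    VanAt (a + b) (fun z => f z * g z) q := by
  intro j hj
  rw [← norm_le_zero_iff]
  refine (norm_iteratedFDeriv_mul_le hf hg q (n := j) (by exact_mod_cast le_top)).trans ?_
  refine le_of_eq (Finset.sum_eq_zero fun i hi => ?_)
  have := Finset.mem_range.1 hi
  by_cases h : i < a
  · simp [h1 i h]
  · simp [h2 (j - i) (by omega)]

lemma VanAt.zero (f : ℂ → ℂ) (q : ℂ) : VanAt 0 f q := fun j hj => absurd hj (by omega)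

lemma VanAt.one {f : ℂ → ℂ} {q : ℂ} (h : f q = 0) : VanAt 1 f q := by
  intro j hj
  obtain rfl : j = 0 := by omega
  ext m
  simp [h]

lemma VanAt.pow {f : ℂ → ℂ} {q : ℂ} (hf : ContDiff ℝ (⊤ : ℕ∞) f) (h : f q = 0) (n : ℕ) :
    VanAt n (fun z => f z ^ n) q := by
  induction n with
  | zero => exact VanAt.zero _ _
  | succ n ih =>
    have := VanAt.mul (hf.pow n) hf ih (VanAt.one h)
    simpa only [pow_succ] using this

lemma VanAt.mono {a b : ℕ} {f : ℂ → ℂ} {q : ℂ} (h : VanAt a f q) (hb : b ≤ a) : VanAt b f q :=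
  fun j hj => h j (by omega)

/-- The linear functional behind `wirtingerBar`. -/
def wbL : (ℂ →L[ℝ] ℂ) →L[ℝ] ℂ :=
  (2⁻¹ : ℂ) • (ContinuousLinearMap.apply ℝ ℂ (1 : ℂ) + I • ContinuousLinearMap.apply ℝ ℂ I)

lemma wirtingerBar_eq (f : ℂ → ℂ) : wirtingerBar f = wbL ∘ fderiv ℝ f := by
  funext z
  simp [wirtingerBar, wbL]
  ring

lemma smooth_fderiv {f : ℂ → ℂ} (hf : ContDiff ℝ (⊤ : ℕ∞) f) :
    ContDiff ℝ (⊤ : ℕ∞) (fderiv ℝ f) := hf.fderiv_right (by simp)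

lemma smooth_wb {f : ℂ → ℂ} (hf : ContDiff ℝ (⊤ : ℕ∞) f) :
    ContDiff ℝ (⊤ : ℕ∞) (wirtingerBar f) := by
  rw [wirtingerBar_eq]; exact wbL.contDiff.comp (smooth_fderiv hf)

lemma VanAt.wb {a : ℕ} {f : ℂ → ℂ} {q : ℂ} (hf : ContDiff ℝ (⊤ : ℕ∞) f) (h : VanAt (a + 1) f q) :
    VanAt a (wirtingerBar f) q := by
  intro j hj
  rw [wirtingerBar_eq, wbL.iteratedFDeriv_comp_left (smooth_fderiv hf).contDiffAt
    (by exact_mod_cast le_top)]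
  have : iteratedFDeriv ℝ j (fderiv ℝ f) q = 0 := by
    rw [← norm_eq_zero, norm_iteratedFDeriv_fderiv, h (j + 1) (by omega), norm_zero]
  rw [this]
  ext m
  simp

lemma wb_mul {f g : ℂ → ℂ} {z : ℂ} (hf : DifferentiableAt ℝ f z) (hg : DifferentiableAt ℝ g z) :
    wirtingerBar (fun z => f z * g z) z = f z * wirtingerBar g z + g z * wirtingerBar f z := by
  simp only [wirtingerBar]
  rw [fderiv_fun_mul hf hg]
  simp
  ring

lemma wb_add {f g : ℂ → ℂ} {z : ℂ} (hf : DifferentiableAt ℝ f z) (hg : DifferentiableAt ℝ g z) :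
    wirtingerBar (fun z => f z + g z) z = wirtingerBar f z + wirtingerBar g z := by
  simp only [wirtingerBar]
  rw [fderiv_fun_add hf hg]
  simp
  ring

lemma wb_pow {f : ℂ → ℂ} {z : ℂ} (hf : DifferentiableAt ℝ f z) (n : ℕ) :
    wirtingerBar (fun z => f z ^ (n + 1)) z = (n + 1) * f z ^ n * wirtingerBar f z := by
  induction n with
  | zero => simp
  | succ n ih =>
    have : (fun z => f z ^ (n + 1 + 1)) = fun z => f z ^ (n + 1) * f z := by
      funext z; rw [pow_succ]
    rw [this, wb_mul (f := fun z => f z ^ (n + 1)) (hf.pow _) hf, ih]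
    push_cast
    ring

lemma wb_congr {f g : ℂ → ℂ} {z : ℂ} (h : f =ᶠ[𝓝 z] g) : wirtingerBar f z = wirtingerBar g z := by
  simp only [wirtingerBar, h.fderiv_eq]

lemma comp_real {γ : ℝ → ℂ} {d x : ℂ} {g : ℂ → ℝ} {g' : ℂ →L[ℝ] ℝ} (h : HasDerivAt γ d (g x))
    (hg : HasFDerivAt g g' x) : HasFDerivAt (fun z => γ (g z)) (g'.smulRight d) x := by
  refine (h.hasFDerivAt.comp x hg).congr_fderiv ?_
  ext v
  simp

lemma gamma_inj {γ : ℝ → ℂ} (hp : Function.Periodic γ 1) (hi : InjOn γ (Ico 0 1)) {s t : ℝ}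
    (h : γ s = γ t) : ∃ n : ℤ, s = t + n := by
  have hf : ∀ x, γ (Int.fract x) = γ x := by
    intro x
    have := hp.sub_int_mul_eq (x := x) ⌊x⌋
    rwa [mul_one] at this
  have h2 : Int.fract s = Int.fract t :=
    hi ⟨Int.fract_nonneg s, Int.fract_lt_one s⟩ ⟨Int.fract_nonneg t, Int.fract_lt_one t⟩
      (by rw [hf, hf, h])
  obtain ⟨n, hn⟩ := Int.fract_eq_fract.1 h2
  exact ⟨n, by linarith⟩

lemma gamma_emb {γ : ℝ → ℂ} (hp : Function.Periodic γ 1) (hi : InjOn γ (Ico 0 1))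
    (hc : Continuous γ) (t0 : ℝ) {ε : ℝ} (hε : 0 < ε) :
    ∃ V : Set ℂ, IsOpen V ∧ γ t0 ∈ V ∧ ∀ t, γ t ∈ V → ∃ n : ℤ, |t + n - t0| < ε := by
  set K : Set ℝ := Icc (t0 - 1/2) (t0 + 1/2) ∩ {t | ε ≤ |t - t0|} with hK
  have hKc : IsCompact K := isCompact_Icc.inter_right
    (isClosed_le continuous_const (by fun_prop))
  refine ⟨(γ '' K)ᶜ, (hKc.image hc).isClosed.isOpen_compl, ?_, ?_⟩
  · rintro ⟨t, ⟨⟨h1, h2⟩, h3⟩, h4⟩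
    obtain ⟨n, hn⟩ := gamma_inj hp hi h4
    have h5 : (n : ℝ) < 1 := by linarith
    have h6 : (-1 : ℝ) < n := by linarith
    have h7 : n < 1 := by exact_mod_cast h5
    have h8 : -1 < n := by exact_mod_cast h6
    obtain rfl : n = 0 := by omega
    simp at hn
    simp [hn] at h3
    linarith
  · intro t ht
    refine ⟨-round (t - t0), ?_⟩
    by_contra hcon
    apply ht
    have h1 := abs_le.1 (abs_sub_round (t - t0))
    refine ⟨t + ((-round (t - t0) : ℤ) : ℝ), ⟨⟨?_, ?_⟩, ?_⟩, ?_⟩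
    · push_cast; linarith [h1.1]
    · push_cast; linarith [h1.2]
    · exact not_lt.1 hcon
    · have := hp.int_mul (-round (t - t0)) t
      simpa using this

lemma local_rho {γ : ℝ → ℂ} (hp : Function.Periodic γ 1) (hi : InjOn γ (Ico 0 1))
    (hs : ContDiff ℝ (⊤ : ℕ∞) γ) (hd : ∀ t, deriv γ t ≠ 0) (t0 : ℝ) :
    ∃ V : Set ℂ, IsOpen V ∧ γ t0 ∈ V ∧ ∃ r : ℂ → ℂ, ContDiffOn ℝ (⊤ : ℕ∞) r V ∧
      ∀ t, γ t ∈ V → r (γ t) = 0 ∧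
        wirtingerBar r (γ t) = - (deriv γ t / (2 * (starRingEnd ℂ) (deriv γ t))) := by
  have hs' : ContDiff ℝ (⊤ : ℕ∞) (deriv γ) := by
    have := (contDiff_infty_iff_deriv (f := γ)).1 hs
    exact this.2
  set F : ℂ → ℂ := fun w => γ w.re + I * w.im * deriv γ w.re with hF
  have hre : ContDiff ℝ (⊤ : ℕ∞) (fun w : ℂ => w.re) := reCLM.contDiff
  have him : ContDiff ℝ (⊤ : ℕ∞) (fun w : ℂ => (w.im : ℂ)) :=
    ofRealCLM.contDiff.comp imCLM.contDiff
  have hFs : ContDiff ℝ (⊤ : ℕ∞) F :=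
    (hs.comp hre).add ((contDiff_const.mul him).mul (hs'.comp hre))
  let mulE : ∀ a : ℂ, a ≠ 0 → (ℂ ≃L[ℝ] ℂ) := fun a ha =>
    (ContinuousLinearEquiv.unitsEquivAut ℂ (Units.mk0 a ha)).restrictScalars ℝ
  have hFd : ∀ t : ℝ, HasFDerivAt F (mulE (deriv γ t) (hd t) : ℂ →L[ℝ] ℂ) (t : ℂ) := by
    intro t
    have h1 : HasFDerivAt (fun w : ℂ => γ w.re) (reCLM.smulRight (deriv γ t)) (t : ℂ) := by
      exact comp_real (g := fun w : ℂ => w.re)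
        ((hs.differentiable (by simp)) t).hasDerivAt reCLM.hasFDerivAt
    have h2 : HasFDerivAt (fun w : ℂ => (w.im : ℂ)) (ofRealCLM.comp imCLM) (t : ℂ) :=
      (ofRealCLM.comp imCLM).hasFDerivAt
    have h3 : HasFDerivAt (fun w : ℂ => deriv γ w.re) (fderiv ℝ (fun w : ℂ => deriv γ w.re) t)
        (t : ℂ) := (((hs'.comp hre).differentiable (by simp)) _).hasFDerivAt
    have h4 := h1.add ((h2.const_mul I).mul h3)
    refine h4.congr_fderiv ?_
    ext v
    have := re_add_im v
    simp [mulE]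
    linear_combination deriv γ t * this
  have hn0 : ((⊤ : ℕ∞) : WithTop ℕ∞) ≠ 0 := by simp
  set e := hFs.contDiffAt.toOpenPartialHomeomorph F (hFd t0) hn0 with he
  have hecoe : (e : ℂ → ℂ) = F := rfl
  have hes : (t0 : ℂ) ∈ e.source :=
    hFs.contDiffAt.mem_toOpenPartialHomeomorph_source (hFd t0) hn0
  set O : Set ℂ := {w | fderiv ℝ F w ∈ range ((↑) : (ℂ ≃L[ℝ] ℂ) → (ℂ →L[ℝ] ℂ))} with hO
  have hOo : IsOpen O := ContinuousLinearEquiv.isOpen.preimage (hFs.continuous_fderiv (by simp))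
  have hOr : ∀ t : ℝ, (t : ℂ) ∈ O := fun t => ⟨_, (hFd t).fderiv.symm⟩
  have hFr : ∀ t : ℝ, F t = γ t := by intro t; simp [hF]
  obtain ⟨ε, hε, hεs⟩ : ∃ ε > 0, ∀ t : ℝ, |t - t0| < ε → (t : ℂ) ∈ e.source := by
    have : (fun t : ℝ => (t : ℂ)) ⁻¹' e.source ∈ 𝓝 t0 :=
      continuous_ofReal.continuousAt.preimage_mem_nhds (e.open_source.mem_nhds hes)
    obtain ⟨ε, hε, h⟩ := Metric.mem_nhds_iff.1 this
    exact ⟨ε, hε, fun t ht => h (by simpa [Real.dist_eq] using ht)⟩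
  obtain ⟨V2, hV2o, hV2m, hV2⟩ := gamma_emb hp hi hs.continuous t0 hε
  refine ⟨(e.target ∩ e.symm ⁻¹' O) ∩ V2, (e.isOpen_inter_preimage_symm hOo).inter hV2o,
    ⟨⟨?_, ?_⟩, hV2m⟩, fun z => z - γ (e.symm z).re, ?_, ?_⟩
  · have := e.map_source hes
    rwa [hecoe, hFr] at this
  · have h := e.left_inv hes
    rw [hecoe, hFr] at h
    simp only [mem_preimage, h]
    exact hOr t0
  · intro z hz
    obtain ⟨⟨hz1, A, hA⟩, -⟩ := hz
    have h1 : ContDiffAt ℝ (⊤ : ℕ∞) e.symm z := by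
      refine e.contDiffAt_symm hz1 (f₀' := A) ?_ hFs.contDiffAt
      rw [hA]
      exact ((hFs.differentiable (by simp)) _).hasFDerivAt
    have h2 : ContDiffAt ℝ (⊤ : ℕ∞) (fun z => γ (e.symm z).re) z :=
      (hs.comp hre).contDiffAt.comp z h1
    exact (contDiffAt_id.sub h2).contDiffWithinAt
  · rintro t ⟨-, htV⟩
    obtain ⟨n, hn⟩ := hV2 t htV
    set s : ℝ := t + n with hs0
    have hsγ : γ t = γ s := by
      have := hp.int_mul n t
      simpa using this.symm
    have hdper : deriv γ t = deriv γ s := by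
      have : (fun x => γ (x + n)) = γ := by
        funext x
        have := hp.int_mul n x
        simpa using this
      have h2 := deriv_comp_add_const γ (n : ℝ) t
      rw [this] at h2
      exact h2
    rw [hsγ, hdper]
    have hss := hεs s hn
    have hinv : e.symm (γ s) = s := by
      have h := e.left_inv hss
      rwa [hecoe, hFr] at h
    have htar : γ s ∈ e.target := by
      have := e.map_source hss
      rwa [hecoe, hFr] at this
    refine ⟨by simp [hinv], ?_⟩
    have h1 : HasFDerivAt e.symm ((mulE (deriv γ s) (hd s)).symm : ℂ →L[ℝ] ℂ) (γ s) := by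
      apply e.hasFDerivAt_symm htar
      rw [hinv]
      exact hFd s
    have h2 : HasFDerivAt (fun z => (e.symm z).re)
        (reCLM.comp ((mulE (deriv γ s) (hd s)).symm : ℂ →L[ℝ] ℂ)) (γ s) :=
      reCLM.hasFDerivAt.comp _ h1
    have h3 := comp_real (γ := γ) (d := deriv γ s) (by
      simpa [hinv] using ((hs.differentiable (by simp)) s).hasDerivAt) h2
    have h4 : HasFDerivAt (fun z => z - γ (e.symm z).re) _ (γ s) := (hasFDerivAt_id (γ s)).sub h3
    rw [wirtingerBar, h4.fderiv]
    have e1 : ∀ v : ℂ, (mulE (deriv γ s) (hd s)).symm v = v * (deriv γ s)⁻¹ := by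
      intro v
      simp [mulE]
    have hds := hd s
    simp only [_root_.sub_apply, ContinuousLinearMap.id_apply,
      ContinuousLinearMap.smulRight_apply, ContinuousLinearMap.comp_apply, reCLM_apply,
      ContinuousLinearEquiv.coe_coe, e1, one_mul, real_smul]
    clear e1 h4 h3 h2 h1
    generalize deriv γ s = d at hds ⊢
    have hcd : (starRingEnd ℂ) d ≠ 0 := by simpa using hds
    have key : ∀ a : ℂ, (a.re : ℂ) + I * ((I * a).re : ℂ) = (starRingEnd ℂ) a := by
      intro a
      apply Complex.ext <;> simp
    have k2 := key d⁻¹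
    rw [map_inv₀] at k2
    have k3 : d / (2 * (starRingEnd ℂ) d) = d * ((starRingEnd ℂ) d)⁻¹ / 2 := by
      field_simp
    rw [k3, ← k2]
    linear_combination (1 / 2 : ℂ) * I_mul_I

lemma global_rho {γ : ℝ → ℂ} (hp : Function.Periodic γ 1) (hi : InjOn γ (Ico 0 1))
    (hs : ContDiff ℝ (⊤ : ℕ∞) γ) (hd : ∀ t, deriv γ t ≠ 0) :
    ∃ r : ℂ → ℂ, ContDiff ℝ (⊤ : ℕ∞) r ∧ HasCompactSupport r ∧
      ∀ t ∈ Icc (0 : ℝ) 1, r (γ t) = 0 ∧ wirtingerBar r (γ t) ≠ 0 := by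
  have hK : IsCompact (γ '' Icc 0 1) := isCompact_Icc.image hs.continuous
  have main := hK.induction_on (p := fun K => ∃ r : ℂ → ℂ, ContDiff ℝ (⊤ : ℕ∞) r ∧
      HasCompactSupport r ∧ ∀ t, r (γ t) = 0 ∧ ∃ a : ℝ, 0 ≤ a ∧ (γ t ∈ K → 0 < a) ∧
      wirtingerBar r (γ t) = a * - (deriv γ t / (2 * (starRingEnd ℂ) (deriv γ t))))
    ?_ ?_ ?_ ?_
  · obtain ⟨r, h1, h2, h3⟩ := main
    refine ⟨r, h1, h2, fun t ht => ⟨(h3 t).1, ?_⟩⟩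
    obtain ⟨-, a, ha, hb, hc⟩ := h3 t
    have ha' := hb ⟨t, ht, rfl⟩
    rw [hc]
    have h0 := hd t
    have : (starRingEnd ℂ) (deriv γ t) ≠ 0 := by simpa using h0
    have h5 : (a : ℂ) ≠ 0 := by exact_mod_cast ha'.ne'
    exact mul_ne_zero h5 (neg_ne_zero.2 (div_ne_zero h0 (mul_ne_zero two_ne_zero this)))
  · refine ⟨fun _ => 0, contDiff_const, HasCompactSupport.zero, fun t => ⟨rfl, 0, le_rfl, ?_, ?_⟩⟩
    · simp
    · simp [wirtingerBar]
  · rintro s t hst ⟨r, h1, h2, h3⟩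
    refine ⟨r, h1, h2, fun x => ⟨(h3 x).1, ?_⟩⟩
    obtain ⟨-, a, ha, hb, hc⟩ := h3 x
    exact ⟨a, ha, fun h => hb (hst h), hc⟩
  · rintro s t ⟨r, h1, h2, h3⟩ ⟨r', h1', h2', h3'⟩
    refine ⟨fun z => r z + r' z, h1.add h1', h2.add h2', fun x => ⟨?_, ?_⟩⟩
    · simp [(h3 x).1, (h3' x).1]
    · obtain ⟨-, a, ha, hb, hc⟩ := h3 x
      obtain ⟨-, a', ha', hb', hc'⟩ := h3' x
      refine ⟨a + a', by positivity, ?_, ?_⟩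
      · rintro (h | h)
        · linarith [hb h]
        · linarith [hb' h]
      · rw [wb_add (h1.differentiable (by simp) _) (h1'.differentiable (by simp) _), hc, hc']
        push_cast
        ring
  · rintro _ ⟨t0, -, rfl⟩
    obtain ⟨V, hVo, hVm, r, hr, hrt⟩ := local_rho hp hi hs hd t0
    obtain ⟨f, hf1, hf2, hf3, hf4, hf5⟩ :=
      exists_contDiff_tsupport_subset (n := ⊤) (hVo.mem_nhds hVm)
    have hfC : ContDiff ℝ (⊤ : ℕ∞) (fun z => (f z : ℂ)) := ofRealCLM.contDiff.comp hf3
    have hprod : ContDiff ℝ (⊤ : ℕ∞) (fun z => (f z : ℂ) * r z) := by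
      rw [contDiff_iff_contDiffAt]
      intro z
      by_cases hz : z ∈ tsupport f
      · exact hfC.contDiffAt.mul (hr.contDiffAt (hVo.mem_nhds (hf1 hz)))
      · have : (fun z => (f z : ℂ) * r z) =ᶠ[𝓝 z] fun _ => 0 := by
          filter_upwards [notMem_tsupport_iff_eventuallyEq.1 hz] with w hw
          simp [hw]
        exact contDiffAt_const.congr_of_eventuallyEq this
    refine ⟨{z | 0 < f z}, ?_, fun z => (f z : ℂ) * r z, hprod, ?_, ?_⟩
    · apply mem_nhdsWithin_of_mem_nhds
      apply (isOpen_lt continuous_const hf3.continuous).mem_nhds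
      simp [hf5]
    · exact HasCompactSupport.mul_right (f := fun z => (f z : ℂ))
        (hf2.comp_left (g := fun x : ℝ => (x : ℂ)) (by simp))
    · intro t
      by_cases ht : γ t ∈ V
      · obtain ⟨h1, h2⟩ := hrt t ht
        refine ⟨by simp [h1], f (γ t), (hf4 ⟨_, rfl⟩).1, fun h => h, ?_⟩
        rw [wb_mul (hfC.differentiable (by simp) _)
          ((hr.contDiffAt (hVo.mem_nhds ht)).differentiableAt (by simp)), h1, h2]
        simp
      · have hz : γ t ∉ tsupport f := fun h => ht (hf1 h)
        have hev := notMem_tsupport_iff_eventuallyEq.1 hz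
        have h0 : f (γ t) = 0 := hev.self_of_nhds
        refine ⟨by simp [h0], 0, le_rfl, fun h => ?_, ?_⟩
        · simp [h0] at h
        · have : (fun z => (f z : ℂ) * r z) =ᶠ[𝓝 (γ t)] fun _ => 0 := by
            filter_upwards [hev] with w hw
            simp [hw]
          rw [wb_congr this]
          simp [wirtingerBar]

lemma exists_mult {K : Set ℂ} (hK : IsCompact K) {d : ℂ → ℂ} (hd : ContDiff ℝ (⊤ : ℕ∞) d)
    (h0 : ∀ q ∈ K, d q ≠ 0) :
    ∃ m : ℂ → ℂ, ContDiff ℝ (⊤ : ℕ∞) m ∧ HasCompactSupport m ∧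
      ∀ q ∈ K, ∀ᶠ z in 𝓝 q, m z * d z = 1 := by
  have hO : IsOpen {z | d z ≠ 0} := isOpen_ne_fun hd.continuous continuous_const
  obtain ⟨L, hLc, hKL, hLO⟩ := exists_compact_between hK hO h0
  obtain ⟨f, hf1, hf2, -⟩ := exists_contMDiffMap_one_nhds_of_subset_interior
    (modelWithCornersSelf ℝ ℂ) (n := (⊤ : ℕ∞)) hK.isClosed hKL
  have hfs : ContDiff ℝ (⊤ : ℕ∞) f := f.contMDiff.contDiff
  have hfC : ContDiff ℝ (⊤ : ℕ∞) (fun z => (f z : ℂ)) := ofRealCLM.contDiff.comp hfs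
  refine ⟨fun z => (f z : ℂ) * (d z)⁻¹, ?_, ?_, ?_⟩
  · rw [contDiff_iff_contDiffAt]
    intro z
    by_cases hz : z ∈ L
    · exact hfC.contDiffAt.mul (hd.contDiffAt.inv (hLO hz))
    · have : (fun z => (f z : ℂ) * (d z)⁻¹) =ᶠ[𝓝 z] fun _ => 0 := by
        filter_upwards [hLc.isClosed.isOpen_compl.mem_nhds hz] with w hw
        simp [hf2 w hw]
      exact contDiffAt_const.congr_of_eventuallyEq this
  · exact HasCompactSupport.intro hLc fun z hz => by simp [hf2 z hz]
  · intro q hq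
    have h1 := (eventually_nhdsSet_iff_forall.1 hf1) q hq
    filter_upwards [h1, hO.mem_nhds (h0 q hq)] with z hz hdz
    have : d z ≠ 0 := hdz
    simp [hz, this]

/-- The coefficients of the formal solution. -/
def coef (m U : ℂ → ℂ) : ℕ → ℂ → ℂ
  | 0 => fun z => m z * U z
  | (k + 1) => fun z => m z * (-(wirtingerBar (coef m U k) z) / (k + 2))

lemma coef_smooth {m U : ℂ → ℂ} (hm : ContDiff ℝ (⊤ : ℕ∞) m) (hU : ContDiff ℝ (⊤ : ℕ∞) U) (k : ℕ) :
    ContDiff ℝ (⊤ : ℕ∞) (coef m U k) := by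
  induction k with
  | zero => exact hm.mul hU
  | succ k ih => exact hm.mul ((smooth_wb ih).neg.div_const _)

lemma coef_supp {m U : ℂ → ℂ} (hm : HasCompactSupport m) (k : ℕ) :
    HasCompactSupport (coef m U k) := by
  cases k with
  | zero => exact hm.mul_right
  | succ k => exact hm.mul_right (f' := fun z => (-(wirtingerBar (coef m U k) z) / (k + 2)))

/-- Partial sums of the formal solution. -/
def psum (m U ρ : ℂ → ℂ) (N : ℕ) (z : ℂ) : ℂ :=
  ∑ k ∈ Finset.range N, coef m U k z * ρ z ^ (k + 1)

lemma psum_smooth {m U ρ : ℂ → ℂ} (hm : ContDiff ℝ (⊤ : ℕ∞) m) (hU : ContDiff ℝ (⊤ : ℕ∞) U)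
    (hρ : ContDiff ℝ (⊤ : ℕ∞) ρ) (N : ℕ) : ContDiff ℝ (⊤ : ℕ∞) (psum m U ρ N) := by
  unfold psum
  exact ContDiff.sum fun k _ => (coef_smooth hm hU k).mul (hρ.pow _)

lemma psum_wb {m U ρ : ℂ → ℂ} (hm : ContDiff ℝ (⊤ : ℕ∞) m) (hU : ContDiff ℝ (⊤ : ℕ∞) U)
    (hρ : ContDiff ℝ (⊤ : ℕ∞) ρ) {z : ℂ} (hz : m z * wirtingerBar ρ z = 1) (N : ℕ) :
    wirtingerBar (psum m U ρ (N + 1)) z =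
      U z + ρ z ^ (N + 1) * wirtingerBar (coef m U N) z := by
  have hterm : ∀ k, wirtingerBar (fun z => coef m U k z * ρ z ^ (k + 1)) z =
      coef m U k z * ((k + 1) * ρ z ^ k * wirtingerBar ρ z) +
      ρ z ^ (k + 1) * wirtingerBar (coef m U k) z := by
    intro k
    rw [wb_mul (g := fun z => ρ z ^ (k + 1)) ((coef_smooth hm hU k).differentiable (by simp) z)
      ((hρ.pow (k + 1)).differentiable (by simp) z),
      wb_pow (hρ.differentiable (by simp) z)]
  induction N with
  | zero =>
    have : psum m U ρ (0 + 1) = fun z => coef m U 0 z * ρ z ^ (0 + 1) := by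
      funext w; simp [psum]
    rw [this, hterm 0]
    simp only [coef]
    push_cast
    linear_combination U z * hz
  | succ N ih =>
    have : psum m U ρ (N + 1 + 1) =
        fun z => psum m U ρ (N + 1) z + coef m U (N + 1) z * ρ z ^ (N + 1 + 1) := by
      funext w; simp only [psum]; rw [Finset.sum_range_succ]
    rw [this, wb_add (g := fun z => coef m U (N + 1) z * ρ z ^ (N + 1 + 1))
      ((psum_smooth hm hU hρ _).differentiable (by simp) z)
      (((coef_smooth hm hU _).mul (hρ.pow _)).differentiable (by simp) z), ih, hterm (N + 1)]
    have hN : (N : ℂ) + 2 ≠ 0 := by exact_mod_cast (by omega : N + 2 ≠ 0)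
    have e : coef m U (N + 1) z * (((N + 1 : ℕ) : ℂ) + 1) =
        - (m z * wirtingerBar (coef m U N) z) := by
      simp only [coef]
      push_cast
      have : (N : ℂ) + 1 + 1 ≠ 0 := by convert hN using 1; ring
      field_simp
      ring
    linear_combination ρ z ^ (N + 1) * wirtingerBar ρ z * e
      - ρ z ^ (N + 1) * wirtingerBar (coef m U N) z * hz

/-- **Theorem 1.2 (i).**  Let `Ω` be a bounded Jordan domain with `C^∞` smooth boundary
and let `U ∈ C^∞(Ω̄)` (given as a smooth function on `ℂ`).  Then there exists
`φ ∈ C^∞(Ω̄)` vanishing identically on `bΩ` such that `∂φ/∂z̄` agrees with `U` to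
infinite order on `bΩ`: all partial derivatives of every order of `∂φ/∂z̄ − U` vanish
at every point of `bΩ`. -/
theorem dbar_infinite_order_matching
    (Ω : Set ℂ) (γ : ℝ → ℂ) (hΩ : SmoothJordanDomain Ω γ)
    (U : ℂ → ℂ) (hU : ContDiff ℝ (⊤ : ℕ∞) U) :
    ∃ φ : ℂ → ℂ, ContDiff ℝ (⊤ : ℕ∞) φ ∧
      EqOn φ 0 (frontier Ω) ∧
      ∀ n : ℕ, ∀ q ∈ frontier Ω,
        iteratedFDeriv ℝ n (fun z => wirtingerBar φ z - U z) q = 0 := by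
  obtain ⟨ρ, hρ, hρc, hρb⟩ := global_rho hΩ.periodic hΩ.injOn hΩ.smooth hΩ.derivNe
  have hK : IsCompact (frontier Ω) := by
    rw [← hΩ.image]; exact isCompact_Icc.image hΩ.smooth.continuous
  have hρ0 : ∀ q ∈ frontier Ω, ρ q = 0 := by
    rw [← hΩ.image]; rintro _ ⟨t, ht, rfl⟩; exact (hρb t ht).1
  have hρ1 : ∀ q ∈ frontier Ω, wirtingerBar ρ q ≠ 0 := by
    rw [← hΩ.image]; rintro _ ⟨t, ht, rfl⟩; exact (hρb t ht).2
  obtain ⟨m, hm, hmc, hmd⟩ := exists_mult hK (smooth_wb hρ) hρ1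
  obtain ⟨χ, hχ, hχc, hχ1⟩ : ∃ χ : ℂ → ℂ, ContDiff ℝ (⊤ : ℕ∞) χ ∧ HasCompactSupport χ ∧
      ∀ q ∈ ({0} : Set ℂ), ∀ᶠ z in 𝓝 q, χ z * (fun _ => (1 : ℂ)) z = 1 :=
    exists_mult isCompact_singleton contDiff_const (by simp)
  have hχ1' : ∀ᶠ z in 𝓝 (0 : ℂ), χ z = 1 := by simpa using hχ1
  choose l hl0 hl using fun k : ℕ => borel_term (coef_smooth hm hU k) (coef_supp (U := U) hmc k)
    hρ hρc hχ hχc k (ε := (1 / 2 : ℝ) ^ k) (by positivity)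
  set f : ℕ → ℂ → ℂ := fun k z => coef m U k z * ρ z ^ (k + 1) * χ (l k • ρ z) with hf
  have hχl : ∀ k, ContDiff ℝ (⊤ : ℕ∞) (fun z => χ (l k • ρ z)) := fun k =>
    hχ.comp (by fun_prop : ContDiff ℝ (⊤ : ℕ∞) (fun z => l k • ρ z))
  have hfs : ∀ k, ContDiff ℝ (⊤ : ℕ∞) (f k) := fun k =>
    ((coef_smooth hm hU k).mul (hρ.pow _)).mul (hχl k)
  have hfc : ∀ k, HasCompactSupport (f k) := fun k => by
    have h := (coef_supp (m := m) (U := U) hmc k).mul_right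
      (f' := fun z => ρ z ^ (k + 1) * χ (l k • ρ z))
    have h2 : f k = coef m U k * fun z => ρ z ^ (k + 1) * χ (l k • ρ z) := by
      funext z
      simp only [hf, Pi.mul_apply, mul_assoc]
    rw [h2]
    exact h
  choose B hB1 hB using fun k n : ℕ => bdd_derivs (hfs k) (hfc k) n
  let v : ℕ → ℕ → ℝ := fun n k => (1 / 2 : ℝ) ^ k + if k < n then B k n else 0
  have hv : ∀ n, Summable (v n) := by
    intro n
    refine (summable_geometric_of_lt_one (by norm_num) (by norm_num)).add ?_
    refine summable_of_ne_finset_zero (s := Finset.range n) fun k hk => ?_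
    have : ¬ k < n := by simpa using hk
    simp [this]
  have hbd : ∀ (n k : ℕ) (x : ℂ), ‖iteratedFDeriv ℝ n (f k) x‖ ≤ v n k := by
    intro n k x
    simp only [v]
    by_cases h : k < n
    · rw [if_pos h]
      have := hB k n n le_rfl x
      have h2 : (0 : ℝ) ≤ (1 / 2) ^ k := by positivity
      linarith
    · rw [if_neg h, add_zero]
      exact hl k n (by omega) x
  have hvan : ∀ k, ∀ q ∈ frontier Ω, VanAt (k + 1) (f k) q := by
    intro k q hq
    have h1 := VanAt.mul (coef_smooth hm hU k) (hρ.pow (k + 1)) (VanAt.zero _ q)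
      (VanAt.pow hρ (hρ0 q hq) (k + 1))
    have h2 := VanAt.mul ((coef_smooth hm hU k).mul (hρ.pow (k + 1))) (hχl k) h1 (VanAt.zero _ q)
    exact h2.mono (by omega)
  have htail : ∀ N, ContDiff ℝ (⊤ : ℕ∞) (fun z => ∑' k, f (k + N) z) := fun N =>
    contDiff_tsum (N := ⊤) (v := fun n k => v n (k + N)) (fun k => hfs _)
      (fun n _ => (summable_nat_add_iff N).2 (hv n)) (fun n k x _ => hbd n _ x)
  have htailv : ∀ N, ∀ q ∈ frontier Ω, VanAt (N + 1) (fun z => ∑' k, f (k + N) z) q := by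
    intro N q hq j hj
    rw [iteratedFDeriv_tsum_apply (N := ⊤) (v := fun n k => v n (k + N)) (fun k => hfs _)
      (fun n _ => (summable_nat_add_iff N).2 (hv n)) (fun n k x _ => hbd n _ x) le_top]
    have : ∀ k, iteratedFDeriv ℝ j (f (k + N)) q = 0 := fun k => hvan (k + N) q hq j (by omega)
    simp [this]
  have hsum : ∀ z, Summable fun k => f k z := by
    intro z
    refine Summable.of_norm_bounded (hv 0) fun k => ?_
    simpa using hbd 0 k z
  refine ⟨fun z => ∑' k, f k z, by simpa using htail 0, ?_, ?_⟩
  · intro q hq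
    have : ∀ k, f k q = 0 := fun k => by simp [hf, hρ0 q hq]
    simp [this]
  · intro n q hq
    have hT := htail (n + 1)
    have hnear : ∀ᶠ z in 𝓝 q, (fun z => ∑' k, f k z) z =
        (fun z => psum m U ρ (n + 1) z + ∑' k, f (k + (n + 1)) z) z := by
      have h1 : ∀ᶠ z in 𝓝 q, ∀ k ∈ Finset.range (n + 1), χ (l k • ρ z) = 1 := by
        rw [Filter.eventually_all_finset]
        intro k _
        have hc : Tendsto (fun z => l k • ρ z) (𝓝 q) (𝓝 0) := by
          have : Continuous (fun z => l k • ρ z) := hρ.continuous.const_smul (l k)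
          have h := this.tendsto q
          simpa [hρ0 q hq] using h
        exact hc.eventually hχ1'
      filter_upwards [h1] with z hz
      rw [← (hsum z).sum_add_tsum_nat_add (n + 1)]
      congr 1
      refine Finset.sum_congr rfl fun k hk => ?_
      simp only [hf, hz k hk, mul_one]
    have hfin : (fun z => wirtingerBar (fun z => ∑' k, f k z) z - U z) =ᶠ[𝓝 q]
        fun z => ρ z ^ (n + 1) * wirtingerBar (coef m U n) z +
          wirtingerBar (fun z => ∑' k, f (k + (n + 1)) z) z := by
      filter_upwards [hnear.eventually_nhds, hmd q hq] with z hz hmz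
      rw [wb_congr hz, wb_add ((psum_smooth hm hU hρ _).differentiable (by simp) z)
        (hT.differentiable (by simp) z), psum_wb hm hU hρ hmz]
      ring
    rw [(Filter.EventuallyEq.iteratedFDeriv ℝ hfin n).self_of_nhds]
    have a1 : VanAt (n + 1 + 0) (fun z => ρ z ^ (n + 1) * wirtingerBar (coef m U n) z) q :=
      VanAt.mul (hρ.pow _) (smooth_wb (coef_smooth hm hU n))
        (VanAt.pow hρ (hρ0 q hq) (n + 1)) (VanAt.zero _ q)
    have a2 : VanAt (n + 1) (wirtingerBar (fun z => ∑' k, f (k + (n + 1)) z)) q :=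
      VanAt.wb hT (htailv (n + 1) q hq)
    have h3 := iteratedFDeriv_add_apply (𝕜 := ℝ) (i := n) (x := q)
      (f := fun z => ρ z ^ (n + 1) * wirtingerBar (coef m U n) z)
      (g := wirtingerBar (fun z => ∑' k, f (k + (n + 1)) z))
      (((hρ.pow (n + 1)).mul (smooth_wb (coef_smooth hm hU n))).contDiffAt.of_le
        (by exact_mod_cast le_top))
      ((smooth_wb hT).contDiffAt.of_le (by exact_mod_cast le_top))
    rw [a1 n (by omega), a2 n (by omega), add_zero] at h3
    exact h3
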